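/- arXiv:2410.23458 — 7 statements merged into one kernel-verified Lean document; each statement's English description precedes it below -/
import Mathlib

section
/- For every natural number k ≥ 1, the determinant of the k×k integer matrix A whose (i,j) entry (for 0 ≤ i,j ≤ k−1) is catalan(i+j) + catalan(i+j+1) equals fib(2k+1). Equivalently, det(H_k(C) + H'_k(C)) = F_{2k+1}, where C is the Catalan sequence. -/
/-- Ballot-type numbers. -/
def balL (n a : ℕ) : ℤ := ((2 * n).choose (n + a) : ℤ) - ((2 * n).choose (n + a + 1) : ℤ)

theorem balL_zero_of_lt {n a : ℕ} (h : n < a) : balL n a = 0 := by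
  unfold balL
  rw [Nat.choose_eq_zero_of_lt (by omega), Nat.choose_eq_zero_of_lt (by omega)]
  simp

theorem choose_two_step (m r : ℕ) :
    (m + 2).choose (r + 2) = m.choose r + 2 * m.choose (r + 1) + m.choose (r + 2) := by
  rw [Nat.choose_succ_succ, Nat.choose_succ_succ m r, Nat.choose_succ_succ m (r + 1)]
  ring

theorem balL_succ_succ (n a : ℕ) :
    balL (n + 1) (a + 1) = balL n a + 2 * balL n (a + 1) + balL n (a + 2) := by
  unfold balL
  have h1 := choose_two_step (2 * n) (n + a)
  have h2 := choose_two_step (2 * n) (n + a + 1)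
  rw [show 2 * (n + 1) = 2 * n + 2 by ring, show n + 1 + (a + 1) = n + a + 2 by ring, h1,
    show n + a + 2 + 1 = n + a + 1 + 2 by ring, h2]
  simp only [← add_assoc]
  push_cast
  ring

theorem balL_succ_zero (n : ℕ) : balL (n + 1) 0 = balL n 0 + balL n 1 := by
  unfold balL
  rcases n with _ | n
  · decide
  have h1 := choose_two_step (2 * (n + 1)) n
  have h2 := choose_two_step (2 * (n + 1)) (n + 1)
  have h3 : (2 * (n + 1)).choose n = (2 * (n + 1)).choose (n + 2) :=
    Nat.choose_symm_of_eq_add (by ring)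
  rw [show 2 * (n + 1 + 1) = 2 * (n + 1) + 2 by ring, show n + 1 + 1 + 0 = n + 2 by ring, h1,
    show n + 2 + 1 = n + 1 + 2 by ring, h2, h3]
  simp only [← add_assoc, add_zero]
  push_cast
  ring

theorem balL_catalan (n : ℕ) : balL n 0 = (catalan n : ℤ) := by
  unfold balL
  have h1 := succ_mul_catalan_eq_centralBinom n
  rw [Nat.centralBinom_eq_two_mul_choose] at h1
  have h2 := Nat.choose_succ_right_eq (2 * n) n
  rw [show 2 * n - n = n by omega] at h2
  have h1' : ((n : ℤ) + 1) * catalan n = (2 * n).choose n := by exact_mod_cast h1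
  have h2' : ((2 * n).choose (n + 1) : ℤ) * (n + 1) = (2 * n).choose n * n := by exact_mod_cast h2
  have h3 : ((n : ℤ) + 1) ≠ 0 := by positivity
  apply mul_left_cancel₀ h3
  rw [add_zero]
  linear_combination -h2' - h1'

theorem balL_wronskian (m n N : ℕ) :
    ∑ a ∈ Finset.range (N + 1), (balL (m + 1) a * balL n a - balL m a * balL (n + 1) a)
      = balL m (N + 1) * balL n N - balL m N * balL n (N + 1) := by
  induction N with
  | zero => simp [balL_succ_zero]; ring
  | succ N ih => rw [Finset.sum_range_succ, ih, balL_succ_succ, balL_succ_succ]; ring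

theorem balL_sum (m : ℕ) : ∀ n N : ℕ, m < N →
    ∑ a ∈ Finset.range N, balL m a * balL n a = (catalan (m + n) : ℤ) := by
  induction m with
  | zero =>
    intro n N h
    rw [Finset.sum_eq_single 0]
    · rw [balL_catalan, balL_catalan]; simp
    · intro b _ hb
      rw [balL_zero_of_lt (Nat.pos_of_ne_zero hb), zero_mul]
    · intro h'; simp at h'; omega
  | succ m ih =>
    intro n N h
    obtain ⟨N, rfl⟩ : ∃ M, N = M + 1 := ⟨N - 1, by omega⟩
    have h1 := balL_wronskian m n N
    rw [Finset.sum_sub_distrib, ih (n + 1) (N + 1) (by omega),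
      balL_zero_of_lt (show m < N + 1 by omega), balL_zero_of_lt (show m < N by omega)] at h1
    rw [show m + 1 + n = m + (n + 1) by ring]
    linarith

/-- The tridiagonal (Jacobi) matrix entries. -/
def triT (a b : ℕ) : ℤ :=
  (if b = a then (if a = 0 then 2 else 3) else 0) + (if b = a + 1 then 1 else 0)
    + (if b + 1 = a then 1 else 0)

theorem triT_sum (k a j : ℕ) (ha : a < k) (hj : j < k) :
    ∑ b ∈ Finset.range k, triT a b * balL j b = balL j a + balL (j + 1) a := by
  have hs : ∑ b ∈ Finset.range k, (if b = a + 1 then (1 : ℤ) else 0) * balL j b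
      = balL j (a + 1) := by
    simp only [ite_mul, one_mul, zero_mul, Finset.sum_ite_eq', Finset.mem_range]
    split_ifs with h
    · rfl
    · rw [balL_zero_of_lt (by omega)]
  simp only [triT, add_mul, Finset.sum_add_distrib, hs]
  rcases a with _ | a
  · simp [ha, balL_succ_zero]; ring
  · simp only [ite_mul, zero_mul, one_mul, Finset.sum_ite_eq', Finset.mem_range, ha,
      add_left_inj, balL_succ_succ, if_true, show a < k by omega, Nat.succ_ne_zero, if_false]
    ring

theorem triT_far (a b : ℕ) (h1 : b ≠ a) (h2 : b ≠ a + 1) (h3 : b + 1 ≠ a) : triT a b = 0 := by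
  simp [triT, h1, h2, h3]

/-- The reversed tridiagonal matrix. -/
def revT (n : ℕ) : Matrix (Fin n) (Fin n) ℤ := Matrix.of fun i j =>
  triT (n - 1 - i) (n - 1 - j)

theorem revT_sub (n : ℕ) : (revT (n + 1)).submatrix Fin.succ Fin.succ = revT n := by
  ext i j
  simp only [revT, Matrix.submatrix_apply, Matrix.of_apply, Fin.val_succ]
  congr 1 <;> omega

theorem revT_rec (n : ℕ) : (revT (n + 2)).det = 3 * (revT (n + 1)).det - (revT n).det := by
  have hz : ∀ i : Fin n, revT (n + 2) 0 i.succ.succ = 0 := by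
    intro i
    have := i.2
    simp only [revT, Matrix.of_apply, Fin.val_succ, Fin.val_zero]
    apply triT_far <;> omega
  have hz' : ∀ i : Fin n, revT (n + 2) i.succ.succ 0 = 0 := by
    intro i
    have := i.2
    simp only [revT, Matrix.of_apply, Fin.val_succ, Fin.val_zero]
    apply triT_far <;> omega
  have h00 : revT (n + 2) 0 0 = 3 := by simp [revT, triT]
  have h01 : revT (n + 2) 0 1 = 1 := by
    simp [revT, triT]
    omega
  have h10 : revT (n + 2) 1 0 = 1 := by
    simp [revT, triT]
    omega
  have hminor : ((revT (n + 2)).submatrix Fin.succ (Fin.succAbove 1)).det = (revT n).det := by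
    rw [Matrix.det_succ_column_zero, Fin.sum_univ_succ, Finset.sum_eq_zero]
    · have e : ((revT (n + 2)).submatrix Fin.succ (Fin.succAbove 1)).submatrix
          (Fin.succAbove 0) Fin.succ = revT n := by
        rw [← revT_sub n, ← revT_sub (n + 1)]
        ext i j
        simp [Matrix.submatrix_apply, Fin.succAbove_zero]
      rw [e]
      simp [h10]
    · intro i _
      simp [hz']
  rw [Matrix.det_succ_row_zero, Fin.sum_univ_succ, Fin.sum_univ_succ, Finset.sum_eq_zero]
  · rw [Fin.succ_zero_eq_one, hminor, h00, h01, Fin.succAbove_zero, revT_sub]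
    simp
    ring
  · intro i _
    simp [hz]

theorem revT_det (n : ℕ) : (revT n).det = (Nat.fib (2 * n + 1) : ℤ) ∧
    (revT (n + 1)).det = (Nat.fib (2 * n + 3) : ℤ) := by
  induction n with
  | zero =>
    refine ⟨by simp, ?_⟩
    rw [Matrix.det_fin_one]
    decide
  | succ n ih =>
    refine ⟨ih.2, ?_⟩
    rw [revT_rec, ih.1, ih.2]
    have h1 : Nat.fib (2 * n + 5) = Nat.fib (2 * n + 3) + Nat.fib (2 * n + 4) := Nat.fib_add_two
    have h2 : Nat.fib (2 * n + 4) = Nat.fib (2 * n + 2) + Nat.fib (2 * n + 3) := Nat.fib_add_two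
    have h3 : Nat.fib (2 * n + 3) = Nat.fib (2 * n + 1) + Nat.fib (2 * n + 2) := Nat.fib_add_two
    rw [show 2 * (n + 1) + 3 = 2 * n + 5 by ring]
    omega

/-- For every `k ≥ 1`, `det (H_k(C) + H'_k(C)) = F_{2k+1}`, where `C` is the Catalan
sequence: the `(i,j)` entry of the matrix is `catalan (i+j) + catalan (i+j+1)`. -/
theorem det_catalan_hankel_sum_eq_fib (k : ℕ) (hk : 1 ≤ k) :
    (Matrix.of fun i j : Fin k =>
      (catalan ((i : ℕ) + (j : ℕ)) : ℤ) +
        (catalan ((i : ℕ) + (j : ℕ) + 1) : ℤ)).det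
      = (Nat.fib (2 * k + 1) : ℤ) := by
  let L : Matrix (Fin k) (Fin k) ℤ := Matrix.of fun i a => balL i a
  let T : Matrix (Fin k) (Fin k) ℤ := Matrix.of fun a b => triT a b
  have hfac : (Matrix.of fun i j : Fin k =>
      (catalan ((i : ℕ) + (j : ℕ)) : ℤ) +
        (catalan ((i : ℕ) + (j : ℕ) + 1) : ℤ)) = L * (T * L.transpose) := by
    ext i j
    have hT : ∀ a : Fin k, (T * L.transpose) a j = balL j a + balL (j + 1) a := by
      intro a
      rw [Matrix.mul_apply, ← triT_sum k a j a.2 j.2, ← Fin.sum_univ_eq_sum_range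
        (fun b => triT a b * balL j b)]
      rfl
    rw [Matrix.mul_apply]
    simp only [hT, Matrix.of_apply, L]
    rw [Fin.sum_univ_eq_sum_range (fun a => balL i a * (balL j a + balL (j + 1) a))]
    simp only [mul_add, Finset.sum_add_distrib]
    rw [balL_sum i j k i.2, balL_sum i (j + 1) k i.2]
    rfl
  have hL : L.det = 1 := by
    rw [Matrix.det_of_lowerTriangular]
    · apply Finset.prod_eq_one
      intro i _
      simp only [L, Matrix.of_apply, balL]
      rw [Nat.choose_eq_zero_of_lt (show 2 * (i : ℕ) < i + i + 1 by omega),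
        show (i : ℕ) + i = 2 * i by ring]
      simp
    · intro i j h
      exact balL_zero_of_lt (by simpa using h)
  have hT : T.det = (revT k).det := by
    rw [← Matrix.det_submatrix_equiv_self Fin.revPerm]
    congr 1
    ext i j
    simp only [T, revT, Matrix.submatrix_apply, Matrix.of_apply, Fin.revPerm_apply, Fin.val_rev]
    congr 1 <;> omega
  rw [hfac, Matrix.det_mul, Matrix.det_mul, Matrix.det_transpose, hL, hT, (revT_det k).1]
  simp
end

section
/- For every natural number k ≥ 1, the determinant of the k×k integer matrix M defined (for 0 ≤ i,j ≤ k−1) by M i j = fib 3 = 2 if i = j = 0; M i j = fib 4 = 3 if i = j ≥ 1; M i j = fib 2 = 1 if |i − j| = 1; and M i j = fib 0 = 0 otherwise, equals fib(2k+1). (This matrix is the path matrix associated to the triangular snake graph of the vertical ladder graph L_{2k−1}.) -/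
/-- Tridiagonal matrix with first diagonal entry `a`, other diagonal entries `3`. -/
def ladderT (a : ℤ) (n : ℕ) : Matrix (Fin n) (Fin n) ℤ :=
  Matrix.of fun i j =>
    if (i : ℕ) = j then (if (i : ℕ) = 0 then a else 3)
    else if (i : ℕ) = (j : ℕ) + 1 ∨ (j : ℕ) = (i : ℕ) + 1 then 1 else 0

theorem ladderT_rec (a : ℤ) (n : ℕ) :
    (ladderT a (n + 2)).det = a * (ladderT 3 (n + 1)).det - (ladderT 3 n).det := by
  have h1 : (ladderT a (n + 2)).submatrix Fin.succ (Fin.succAbove 0) = ladderT 3 (n + 1) := by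
    ext i j
    simp [ladderT]
  have h2 : ((ladderT a (n + 2)).submatrix Fin.succ (Fin.succAbove (Fin.succ 0))).det
      = (ladderT 3 n).det := by
    rw [Matrix.det_succ_column_zero, Fin.sum_univ_succ, Finset.sum_eq_zero]
    · have h3 : ((ladderT a (n + 2)).submatrix Fin.succ (Fin.succAbove (Fin.succ 0))).submatrix
          (Fin.succAbove 0) Fin.succ = ladderT 3 n := by
        ext i j
        simp [ladderT, Fin.succ_succAbove_succ]
      rw [h3]
      simp [ladderT]
    · intro i _
      simp [ladderT]
  rw [Matrix.det_succ_row_zero, Fin.sum_univ_succ, Fin.sum_univ_succ, Finset.sum_eq_zero, h1, h2]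
  · simp [ladderT]
    ring
  · intro i _
    simp [ladderT]

theorem ladderT_three (n : ℕ) : (ladderT 3 n).det = (Nat.fib (2 * n + 2) : ℤ) ∧
    (ladderT 3 (n + 1)).det = (Nat.fib (2 * n + 4) : ℤ) := by
  induction n with
  | zero => simp [ladderT, Nat.fib_add_two]
  | succ n ih =>
    refine ⟨ih.2, ?_⟩
    rw [ladderT_rec, ih.1, ih.2]
    have e : 2 * (n + 1) + 4 = 2 * n + 2 + 2 + 2 := by ring
    rw [e, show 2 * n + 4 = 2 * n + 2 + 2 by ring]
    simp only [Nat.fib_add_two (n := 2 * n + 2 + 2), Nat.fib_add_two (n := 2 * n + 2 + 1),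
      Nat.fib_add_two (n := 2 * n + 2)]
    push_cast
    ring

/-- For every `k ≥ 1`, the determinant of the `k × k` tridiagonal matrix with diagonal
entries `fib 3 = 2` (first) and `fib 4 = 3` (the rest), off-diagonal entries
`fib 2 = 1` when `|i - j| = 1`, and `fib 0 = 0` otherwise, equals `fib (2k+1)`.
This is the path matrix of the triangular snake graph of the ladder graph `L_{2k-1}`. -/
theorem det_ladder_path_matrix_odd (k : ℕ) (hk : 1 ≤ k) :
    (Matrix.of fun i j : Fin k =>
      if i = j then (if (i : ℕ) = 0 then (Nat.fib 3 : ℤ) else (Nat.fib 4 : ℤ))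
      else if (i : ℕ) = (j : ℕ) + 1 ∨ (j : ℕ) = (i : ℕ) + 1 then (Nat.fib 2 : ℤ)
      else (Nat.fib 0 : ℤ)).det
      = (Nat.fib (2 * k + 1) : ℤ) := by
  have h : (Matrix.of fun i j : Fin k =>
      if i = j then (if (i : ℕ) = 0 then (Nat.fib 3 : ℤ) else (Nat.fib 4 : ℤ))
      else if (i : ℕ) = (j : ℕ) + 1 ∨ (j : ℕ) = (i : ℕ) + 1 then (Nat.fib 2 : ℤ)
      else (Nat.fib 0 : ℤ)) = ladderT 2 k := by
    ext i j
    simp [ladderT, Fin.ext_iff, Nat.fib_add_two]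
  rw [h]
  match k, hk with
  | 1, _ => simp [ladderT, Nat.fib_add_two]
  | n + 2, _ =>
    rw [ladderT_rec, (ladderT_three n).1, (ladderT_three n).2]
    rw [show 2 * (n + 2) + 1 = 2 * n + 2 + 1 + 2 by ring, show 2 * n + 4 = 2 * n + 2 + 2 by ring]
    simp only [Nat.fib_add_two (n := 2 * n + 2 + 1), Nat.fib_add_two (n := 2 * n + 2)]
    push_cast
    ring
end

section
/- For every natural number k ≥ 2, the determinant of the k×k integer matrix M defined (for 0 ≤ i,j ≤ k−1) by M i j = fib 3 = 2 if i = j = 0 or i = j = k−1; M i j = fib 4 = 3 if i = j with 0 < i < k−1; M i j = fib 2 = 1 if |i − j| = 1; and M i j = fib 0 = 0 otherwise, equals fib(2k). (This matrix is the path matrix associated to the triangular snake graph of the vertical ladder graph L_{2k−2}.) -/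
/-- Tridiagonal matrix with diagonal `d` and off-diagonal entries `1`. -/
def triMat (d : ℕ → ℤ) (n : ℕ) : Matrix (Fin n) (Fin n) ℤ :=
  Matrix.of fun i j =>
    if (i : ℕ) = (j : ℕ) then d i
    else if (i : ℕ) = (j : ℕ) + 1 ∨ (j : ℕ) = (i : ℕ) + 1 then 1 else 0

theorem triMat_det (d : ℕ → ℤ) (n : ℕ) :
    (triMat d (n + 2)).det =
      d 0 * (triMat (fun i => d (i + 1)) (n + 1)).det
        - (triMat (fun i => d (i + 2)) n).det := by
  have h1 : (triMat d (n + 2)).submatrix Fin.succ (Fin.succAbove 0)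
      = triMat (fun i => d (i + 1)) (n + 1) := by
    ext i j
    simp [triMat]
  have h2 : ((triMat d (n + 2)).submatrix Fin.succ (Fin.succAbove (Fin.succ 0))).det
      = (triMat (fun i => d (i + 2)) n).det := by
    rw [Matrix.det_succ_column_zero, Fin.sum_univ_succ, Finset.sum_eq_zero]
    · have h3 : ((triMat d (n + 2)).submatrix Fin.succ (Fin.succAbove (Fin.succ 0))).submatrix
          (Fin.succAbove 0) Fin.succ = triMat (fun i => d (i + 2)) n := by
        ext i j
        simp [triMat]
      rw [h3]
      simp [triMat]
    · intro i _
      simp [triMat]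
  rw [Matrix.det_succ_row_zero, Fin.sum_univ_succ, Fin.sum_univ_succ, Finset.sum_eq_zero, h1, h2]
  · simp [triMat]
    ring
  · intro i _
    simp [triMat]

theorem triMat_tail (m : ℕ) :
    (triMat (fun i => if i + 1 = m then 2 else 3) m).det = (Nat.fib (2 * m + 1) : ℤ) := by
  induction m using Nat.twoStepInduction with
  | zero => simp
  | one => simp [triMat, Nat.fib_add_two]
  | more n ih1 ih2 =>
    rw [triMat_det]
    simp only [Nat.add_right_cancel_iff, show ∀ i, (i + 2 + 1 = n + 2) ↔ i + 1 = n by omega,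
      show ∀ i, (i + 1 + 1 = n + 2) ↔ i + 1 = n + 1 by omega] at *
    rw [ih1, ih2]
    have e : 2 * (n + 2) + 1 = 2 * n + 1 + 2 + 2 := by ring
    have e' : 2 * (n + 1) + 1 = 2 * n + 1 + 2 := by ring
    rw [e, e']
    simp [Nat.fib_add_two]
    ring

/-- For every `k ≥ 2`, the determinant of the `k × k` tridiagonal matrix with diagonal
entries `fib 3 = 2` (first and last) and `fib 4 = 3` (in between), entries `fib 2 = 1`
when `|i - j| = 1`, and `fib 0 = 0` otherwise, equals `fib (2k)`.
This is the path matrix of the triangular snake graph of the ladder graph `L_{2k-2}`. -/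
theorem det_ladder_path_matrix_even (k : ℕ) (hk : 2 ≤ k) :
    (Matrix.of fun i j : Fin k =>
      if i = j then
        (if (i : ℕ) = 0 ∨ (i : ℕ) = k - 1 then (Nat.fib 3 : ℤ) else (Nat.fib 4 : ℤ))
      else if (i : ℕ) = (j : ℕ) + 1 ∨ (j : ℕ) = (i : ℕ) + 1 then (Nat.fib 2 : ℤ)
      else (Nat.fib 0 : ℤ)).det
      = (Nat.fib (2 * k) : ℤ) := by
  obtain ⟨n, rfl⟩ : ∃ n, k = n + 2 := ⟨k - 2, by omega⟩
  have h : (Matrix.of fun i j : Fin (n + 2) =>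
      if i = j then
        (if (i : ℕ) = 0 ∨ (i : ℕ) = n + 2 - 1 then (Nat.fib 3 : ℤ) else (Nat.fib 4 : ℤ))
      else if (i : ℕ) = (j : ℕ) + 1 ∨ (j : ℕ) = (i : ℕ) + 1 then (Nat.fib 2 : ℤ)
      else (Nat.fib 0 : ℤ))
      = triMat (fun i => if i = 0 ∨ i = n + 1 then 2 else 3) (n + 2) := by
    ext i j
    have f0 : Nat.fib 0 = 0 := rfl
    have f2 : Nat.fib 2 = 1 := rfl
    have f3 : Nat.fib 3 = 2 := rfl
    have f4 : Nat.fib 4 = 3 := rfl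
    have hn : n + 2 - 1 = n + 1 := rfl
    simp only [triMat, Matrix.of_apply, Fin.ext_iff, f0, f2, f3, f4, hn]
    norm_cast
  rw [h, triMat_det]
  have t1 := triMat_tail (n + 1)
  have t2 := triMat_tail n
  have g1 : (fun i : ℕ => if i + 1 = 0 ∨ i + 1 = n + 1 then (2 : ℤ) else 3)
      = fun i => if i + 1 = n + 1 then 2 else 3 := by
    funext i
    exact if_congr (by omega) rfl rfl
  have g2 : (fun i : ℕ => if i + 2 = 0 ∨ i + 2 = n + 1 then (2 : ℤ) else 3)
      = fun i => if i + 1 = n then 2 else 3 := by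
    funext i
    exact if_congr (by omega) rfl rfl
  rw [g1, g2, if_pos (Or.inl rfl)]
  rw [t1, t2]
  have e : 2 * (n + 2) = 2 * n + 2 + 2 := by ring
  have e' : 2 * (n + 1) + 1 = 2 * n + 1 + 2 := by ring
  rw [e, e']
  simp [Nat.fib_add_two]
  ring
end

section
/- For every natural number k ≥ 1, the determinant of the k×k integer Hankel matrix H'_k(C) with (i,j) entry catalan(i+j+1) (for 0 ≤ i,j ≤ k−1) equals 1. -/
/-- The ballot-type triangle used for the factorization. -/
def catTri (n j : ℕ) : ℤ := ((2*n+1).choose (n+j+1) : ℤ) - ((2*n+1).choose (n+j+2) : ℤ)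

theorem catTri_zero_of_lt {n j : ℕ} (h : n < j) : catTri n j = 0 := by
  unfold catTri
  rw [Nat.choose_eq_zero_of_lt (by omega), Nat.choose_eq_zero_of_lt (by omega)]; simp

theorem catTri_self (n : ℕ) : catTri n n = 1 := by
  unfold catTri
  rw [Nat.choose_eq_zero_of_lt (k := n+n+2) (by omega), show n+n+1 = 2*n+1 by ring, Nat.choose_self]
  simp

theorem choose_two (n r : ℕ) : ((n+2).choose (r+2) : ℤ) =
    n.choose r + 2 * n.choose (r+1) + n.choose (r+2) := by
  rw [Nat.choose_succ_succ, Nat.choose_succ_succ, Nat.choose_succ_succ n (r+1)]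
  push_cast; ring

theorem catTri_succ_succ (n j : ℕ) :
    catTri (n+1) (j+1) = catTri n j + 2 * catTri n (j+1) + catTri n (j+2) := by
  unfold catTri
  have h1 := choose_two (2*n+1) (n+j+1)
  have h2 := choose_two (2*n+1) (n+j+2)
  rw [show 2*(n+1)+1 = 2*n+1+2 by ring, show n+1+(j+1)+1 = n+j+1+2 by ring,
    show n+1+(j+1)+2 = n+j+2+2 by ring, h1, h2]
  simp only [← add_assoc]
  ring_nf

theorem catTri_succ_zero (n : ℕ) :
    catTri (n+1) 0 = 2 * catTri n 0 + catTri n 1 := by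
  unfold catTri
  have h1 := choose_two (2*n+1) n
  have h2 := choose_two (2*n+1) (n+1)
  have h3 : (2*n+1).choose n = (2*n+1).choose (n+1) :=
    Nat.choose_symm_of_eq_add (by ring)
  rw [h3] at h1
  rw [show 2*(n+1)+1 = 2*n+1+2 by ring, show n+1+0+1 = n+2 by ring,
    show n+1+0+2 = n+1+2 by ring, h1, h2]
  ring_nf

theorem catTri_zero (n : ℕ) : catTri n 0 = catalan (n+1) := by
  unfold catTri
  have h := succ_mul_catalan_eq_centralBinom (n+1)
  rw [Nat.centralBinom_eq_two_mul_choose, show 2*(n+1) = 2*n+1+1 by ring,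
    Nat.choose_succ_succ] at h
  have h3 : (2*n+1).choose n = (2*n+1).choose (n+1) :=
    Nat.choose_symm_of_eq_add (by ring)
  have h4 := Nat.choose_succ_right_eq (2*n+1) (n+1)
  rw [show 2*n+1-(n+1) = n by omega] at h4
  simp only [Nat.succ_eq_add_one, h3] at h
  simp only [add_zero]
  zify at h h4
  have : ((n:ℤ)+2) ≠ 0 := by positivity
  apply mul_left_cancel₀ this
  rw [show n+1+1 = n+2 by ring] at h4
  linarith

theorem catTri_shift (m n N : ℕ) :
    ∑ j ∈ Finset.range (N+1), catTri (m+1) j * catTri n j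
      - ∑ j ∈ Finset.range (N+1), catTri m j * catTri (n+1) j
      = catTri m (N+1) * catTri n N - catTri m N * catTri n (N+1) := by
  induction N with
  | zero => simp [catTri_succ_zero]; ring
  | succ N ih =>
    rw [Finset.sum_range_succ, Finset.sum_range_succ _ (N+1), catTri_succ_succ, catTri_succ_succ]
    linear_combination ih

theorem catTri_conv (m : ℕ) : ∀ n N : ℕ, m + n < N →
    ∑ j ∈ Finset.range N, catTri m j * catTri n j = catTri (m+n) 0 := by
  induction m with
  | zero =>
    intro n N h
    obtain ⟨N, rfl⟩ : ∃ M, N = M+1 := ⟨N-1, by omega⟩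
    rw [Finset.sum_range_succ', Finset.sum_eq_zero]
    · simp [catTri_self]
    · intro j _
      rw [catTri_zero_of_lt (by omega)]; simp
  | succ m ih =>
    intro n N h
    obtain ⟨N, rfl⟩ : ∃ M, N = M+1 := ⟨N-1, by omega⟩
    have h1 := catTri_shift m n N
    rw [ih (n+1) (N+1) (by omega), catTri_zero_of_lt (n := m) (j := N+1) (by omega),
      catTri_zero_of_lt (n := n) (j := N+1) (by omega)] at h1
    rw [show m+1+n = m+(n+1) by ring]
    linarith

/-- For every `k ≥ 1`, the determinant of the `k × k` Hankel matrix `H'_k(C)` with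
`(i,j)` entry `catalan (i+j+1)` equals `1`. -/
theorem det_catalan_hankel_shifted_eq_one (k : ℕ) (hk : 1 ≤ k) :
    (Matrix.of fun i j : Fin k =>
      (catalan ((i : ℕ) + (j : ℕ) + 1) : ℤ)).det = 1 := by
  let L : Matrix (Fin k) (Fin k) ℤ := Matrix.of fun i j => catTri i j
  have hL : L.det = 1 := by
    rw [Matrix.det_of_isLowerTriangular]
    · simp [L, catTri_self]
    · intro i j hij
      exact catTri_zero_of_lt (by simpa using hij)
  have hM : (Matrix.of fun i j : Fin k =>
      (catalan ((i : ℕ) + (j : ℕ) + 1) : ℤ)) = L * L.transpose := by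
    ext i j
    simp only [Matrix.mul_apply, Matrix.transpose_apply, Matrix.of_apply, L]
    rw [Fin.sum_univ_eq_sum_range (fun x => catTri i x * catTri j x) k, ← catTri_zero,
      ← catTri_conv i j (k + k) (by omega)]
    symm
    apply Finset.sum_subset
    · intro x; simp; omega
    · intro x _ hx
      rw [catTri_zero_of_lt (by simp at hx; omega)]; simp
  rw [hM, Matrix.det_mul, Matrix.det_transpose, hL]; rfl
end

section
/- Let P : ℕ → ℤ be the Pell numbers, i.e., P 0 = 0, P 1 = 1, and P (n+2) = 2·P (n+1) + P n for all n. For every natural number k ≥ 1, the determinant of the k×k integer matrix M defined (for 0 ≤ i,j ≤ k−1) by M i j = fib 5 = 5 if i = j = 0; M i j = fib 5 + fib 3 = 7 if i = j ≥ 1; M i j = fib 4 · fib 3 = 6 if i = 0 and j ≥ 1; M i j = (fib 4 + fib 2) · fib 3 = 8 if 1 ≤ i < j; M i j = fib 2 = 1 if i = j + 1; and M i j = fib 0 = 0 otherwise, equals P (2k+1). -/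
/-- Hessenberg matrix with first row `a, b, b, …`. -/
def pellAux (a b : ℤ) (n : ℕ) : Matrix (Fin n) (Fin n) ℤ :=
  Matrix.of fun i j : Fin n =>
    if (i : ℕ) = 0 then (if (j : ℕ) = 0 then a else b)
    else if (i : ℕ) = (j : ℕ) then 7
    else if (i : ℕ) < (j : ℕ) then 8
    else if (i : ℕ) = (j : ℕ) + 1 then 1
    else 0

theorem pellAux_rec (a b : ℤ) (n : ℕ) :
    (pellAux a b (n + 2)).det
      = a * (pellAux 7 8 (n + 1)).det - (pellAux b b (n + 1)).det := by
  rw [Matrix.det_succ_column_zero, Fin.sum_univ_succ, Fin.sum_univ_succ]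
  have h0 : (pellAux a b (n + 2)).submatrix (Fin.succAbove 0) Fin.succ = pellAux 7 8 (n + 1) := by
    ext i j
    simp only [pellAux, Matrix.submatrix_apply, Matrix.of_apply, Fin.succAbove_zero, Fin.val_succ,
      Nat.add_right_cancel_iff, Nat.add_lt_add_iff_right, Nat.succ_ne_zero, if_false]
    split_ifs <;> first | rfl | omega
  have h1 : (pellAux a b (n + 2)).submatrix (Fin.succAbove (Fin.succ 0)) Fin.succ
      = pellAux b b (n + 1) := by
    ext i j
    refine Fin.cases ?_ (fun i => ?_) i
    · simp [pellAux]
    · simp only [pellAux, Matrix.submatrix_apply, Matrix.of_apply, Fin.succ_succAbove_succ,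
        Fin.succAbove_zero, Fin.val_succ,
      Nat.add_right_cancel_iff, Nat.add_lt_add_iff_right, Nat.succ_ne_zero, if_false]
  have h2 : ∀ i : Fin n, pellAux a b (n + 2) i.succ.succ 0 = 0 := by
    intro i
    simp [pellAux]
  rw [h0, h1]
  simp only [h2]
  simp [pellAux]
  ring

theorem pellAux_det (P : ℕ → ℤ) (hP0 : P 0 = 0) (hP1 : P 1 = 1)
    (hP : ∀ n, P (n + 2) = 2 * P (n + 1) + P n) (n : ℕ) : ∀ a b : ℤ,
    2 * (pellAux a b (n + 1)).det
      = 2 * a * (P (2 * n + 1) + P (2 * n)) - b * P (2 * n) := by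
  induction n with
  | zero => intro a b; simp [pellAux, hP0, hP1]
  | succ n ih =>
    intro a b
    have e1 := hP (2 * n)
    have e2 := hP (2 * n + 1)
    have i1 := ih 7 8
    have i2 := ih b b
    rw [pellAux_rec, show 2 * (n + 1) + 1 = 2 * n + 1 + 2 by ring,
      show 2 * (n + 1) = 2 * n + 2 by ring, e2, show 2 * n + 1 + 1 = 2 * n + 2 by ring, e1]
    linear_combination a * i1 - i2

/-- Let `P` be the Pell numbers. For every `k ≥ 1`, the determinant of the `k × k`
matrix with entries `fib 5 = 5` if `i = j = 0`; `fib 5 + fib 3 = 7` if `i = j ≥ 1`;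
`fib 4 * fib 3 = 6` if `i = 0` and `j ≥ 1`; `(fib 4 + fib 2) * fib 3 = 8` if
`1 ≤ i < j`; `fib 2 = 1` if `i = j + 1`; and `fib 0 = 0` otherwise, equals `P (2k+1)`. -/
theorem det_pell_path_matrix_odd (P : ℕ → ℤ) (hP0 : P 0 = 0) (hP1 : P 1 = 1)
    (hP : ∀ n, P (n + 2) = 2 * P (n + 1) + P n) (k : ℕ) (hk : 1 ≤ k) :
    (Matrix.of fun i j : Fin k =>
      if (i : ℕ) = 0 ∧ (j : ℕ) = 0 then (Nat.fib 5 : ℤ)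
      else if (i : ℕ) = (j : ℕ) then ((Nat.fib 5 : ℤ) + (Nat.fib 3 : ℤ))
      else if (i : ℕ) = 0 then ((Nat.fib 4 : ℤ) * (Nat.fib 3 : ℤ))
      else if (i : ℕ) < (j : ℕ) then (((Nat.fib 4 : ℤ) + (Nat.fib 2 : ℤ)) * (Nat.fib 3 : ℤ))
      else if (i : ℕ) = (j : ℕ) + 1 then (Nat.fib 2 : ℤ)
      else (Nat.fib 0 : ℤ)).det
      = P (2 * k + 1) := by
  obtain ⟨n, rfl⟩ : ∃ n, k = n + 1 := ⟨k - 1, by omega⟩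
  have h := pellAux_det P hP0 hP1 hP n 5 6
  have e1 := hP (2 * n)
  have e2 := hP (2 * n + 1)
  have hM : (2 : ℤ) * (pellAux 5 6 (n + 1)).det = 2 * P (2 * (n + 1) + 1) := by
    rw [h, show 2 * (n + 1) + 1 = 2 * n + 1 + 2 by ring, e2,
      show 2 * n + 1 + 1 = 2 * n + 2 by ring, e1]
    ring
  have hM' : (pellAux 5 6 (n + 1)).det = P (2 * (n + 1) + 1) := by linarith
  rw [← hM']
  congr 1
  ext i j
  have f5 : Nat.fib 5 = 5 := by decide
  have f4 : Nat.fib 4 = 3 := by decide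
  have f3 : Nat.fib 3 = 2 := by decide
  have f2 : Nat.fib 2 = 1 := by decide
  have f0 : Nat.fib 0 = 0 := by decide
  simp only [pellAux, Matrix.of_apply, f5, f4, f3, f2, f0]
  split_ifs <;> first | rfl | omega
end

section
/- Let P : ℕ → ℤ be the Pell numbers, i.e., P 0 = 0, P 1 = 1, and P (n+2) = 2·P (n+1) + P n for all n. For every natural number k ≥ 2, the determinant of the k×k integer matrix M' defined (for 0 ≤ i,j ≤ k−1) by M' i j = fib 5 = 5 if i = j = 0; M' i j = fib 5 + fib 3 = 7 if i = j with 1 ≤ i ≤ k−2; M' i j = fib 4 · fib 3 = 6 if i = 0 and 1 ≤ j ≤ k−2; M' i j = (fib 4 + fib 2) · fib 3 = 8 if 1 ≤ i < j ≤ k−2; M' i j = fib 4 + fib 2 = 4 if 1 ≤ i ≤ k−2 and j = k−1; M' i j = fib 4 = 3 if (i = 0 or i = k−1) and j = k−1; M' i j = fib 2 = 1 if i = j + 1; and M' i j = fib 0 = 0 otherwise, equals P (2k). -/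
/-- Hessenberg matrix of size `n + 2` whose first row is `(a, b, ..., b, c)`. -/
def hessAux (n : ℕ) (a b c : ℤ) : Matrix (Fin (n + 2)) (Fin (n + 2)) ℤ :=
  Matrix.of fun i j =>
    if (i : ℕ) = 0 then
      (if (j : ℕ) = n + 1 then c else if (j : ℕ) = 0 then a else b)
    else if (j : ℕ) = n + 1 then (if (i : ℕ) = n + 1 then 3 else 4)
    else if (i : ℕ) = (j : ℕ) then 7
    else if (i : ℕ) < (j : ℕ) then 8
    else if (i : ℕ) = (j : ℕ) + 1 then 1
    else 0

lemma hessAux_zero (a b c : ℤ) : (hessAux 0 a b c).det = 3 * a - c := by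
  rw [Matrix.det_fin_two]
  simp [hessAux]
  ring

lemma hessAux_succ (n : ℕ) (a b c : ℤ) :
    (hessAux (n + 1) a b c).det = a * (hessAux n 7 8 4).det - (hessAux n b b c).det := by
  rw [Matrix.det_succ_column_zero, Fin.sum_univ_succ, Fin.sum_univ_succ]
  have h0 : (hessAux (n + 1) a b c).submatrix (Fin.succAbove 0) Fin.succ = hessAux n 7 8 4 := by
    ext i j
    have hi := i.2
    have hj := j.2
    simp only [hessAux, Matrix.submatrix_apply, Matrix.of_apply, Fin.zero_succAbove, Fin.val_succ,
      Nat.add_eq_zero_iff, one_ne_zero, and_false, if_false, Nat.add_right_cancel_iff,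
      Nat.add_lt_add_iff_right]
    split_ifs <;> first | rfl | omega
  have h1 : (hessAux (n + 1) a b c).submatrix (Fin.succAbove (Fin.succ 0)) Fin.succ
      = hessAux n b b c := by
    ext i j
    have hj := j.2
    refine Fin.cases ?_ (fun i => ?_) i
    · simp only [hessAux, Matrix.submatrix_apply, Matrix.of_apply, Fin.succ_succAbove_zero,
        Fin.val_succ, Fin.val_zero, Nat.add_eq_zero_iff, one_ne_zero, and_false, if_false,
        if_true, Nat.add_right_cancel_iff, Nat.add_lt_add_iff_right]
      split_ifs <;> first | rfl | omega
    · have hi := i.2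
      simp only [hessAux, Matrix.submatrix_apply, Matrix.of_apply, Fin.succ_succAbove_succ,
        Fin.zero_succAbove, Fin.val_succ,
      Nat.add_eq_zero_iff, one_ne_zero, and_false, if_false, Nat.add_right_cancel_iff,
      Nat.add_lt_add_iff_right]
  rw [h0, h1]
  rw [Finset.sum_eq_zero]
  · simp [hessAux]
    ring
  · intro i _
    simp [hessAux]

lemma hessAux_vals (P : ℕ → ℤ) (hP0 : P 0 = 0) (hP1 : P 1 = 1)
    (hP : ∀ n, P (n + 2) = 2 * P (n + 1) + P n) (n : ℕ) :
    (hessAux n 7 8 4).det = P (2 * n + 4) + P (2 * n + 3) ∧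
    ∀ t, (hessAux n (2 * t) (2 * t) t).det = t * P (2 * n + 3) := by
  induction n with
  | zero =>
    have h2 := hP 0
    have h3 := hP 1
    have h4 := hP 2
    norm_num [hP0, hP1] at h2 h3 h4
    rw [h2] at h3 h4
    rw [h3] at h4
    simp only [hessAux_zero, mul_zero, zero_add, h3, h4]
    exact ⟨by norm_num, fun t => by ring⟩
  | succ n ih =>
    obtain ⟨hx, hy⟩ := ih
    have h5 : P (2 * (n + 1) + 3) = 2 * P (2 * n + 4) + P (2 * n + 3) := hP (2 * n + 3)
    have h6 : P (2 * (n + 1) + 4) = 2 * P (2 * (n + 1) + 3) + P (2 * n + 4) := hP (2 * n + 4)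
    refine ⟨?_, fun t => ?_⟩
    · have h8 := hy 4
      norm_num at h8
      rw [hessAux_succ, hx, h8, h6, h5]
      ring
    · rw [hessAux_succ, hx, hy, h5]
      ring

/-- Let `P` be the Pell numbers. For every `k ≥ 2`, the determinant of the `k × k`
matrix `M'` with entries `fib 5 = 5` if `i = j = 0`; `fib 5 + fib 3 = 7` if `i = j`
with `1 ≤ i ≤ k-2`; `fib 4 * fib 3 = 6` if `i = 0` and `1 ≤ j ≤ k-2`;
`(fib 4 + fib 2) * fib 3 = 8` if `1 ≤ i < j ≤ k-2`; `fib 4 + fib 2 = 4` if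
`1 ≤ i ≤ k-2` and `j = k-1`; `fib 4 = 3` if (`i = 0` or `i = k-1`) and `j = k-1`;
`fib 2 = 1` if `i = j + 1`; and `fib 0 = 0` otherwise, equals `P (2k)`. -/
theorem det_pell_path_matrix_even (P : ℕ → ℤ) (hP0 : P 0 = 0) (hP1 : P 1 = 1)
    (hP : ∀ n, P (n + 2) = 2 * P (n + 1) + P n) (k : ℕ) (hk : 2 ≤ k) :
    (Matrix.of fun i j : Fin k =>
      if (j : ℕ) = k - 1 then
        (if (i : ℕ) = 0 ∨ (i : ℕ) = k - 1 then (Nat.fib 4 : ℤ)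
         else ((Nat.fib 4 : ℤ) + (Nat.fib 2 : ℤ)))
      else if (i : ℕ) = 0 ∧ (j : ℕ) = 0 then (Nat.fib 5 : ℤ)
      else if (i : ℕ) = (j : ℕ) then ((Nat.fib 5 : ℤ) + (Nat.fib 3 : ℤ))
      else if (i : ℕ) = 0 then ((Nat.fib 4 : ℤ) * (Nat.fib 3 : ℤ))
      else if (i : ℕ) < (j : ℕ) then (((Nat.fib 4 : ℤ) + (Nat.fib 2 : ℤ)) * (Nat.fib 3 : ℤ))
      else if (i : ℕ) = (j : ℕ) + 1 then (Nat.fib 2 : ℤ)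
      else (Nat.fib 0 : ℤ)).det
      = P (2 * k) := by
  obtain ⟨n, rfl⟩ : ∃ n, k = n + 2 := ⟨k - 2, by omega⟩
  trans (hessAux n 5 6 3).det
  · congr 1
    ext i j
    have hi := i.2
    have hj := j.2
    simp only [hessAux, Matrix.of_apply]
    split_ifs <;> first | omega | norm_num [Nat.fib]
  · cases n with
    | zero =>
      have h2 := hP 0
      have h3 := hP 1
      have h4 := hP 2
      norm_num [hP0, hP1] at h2 h3 h4
      rw [hessAux_zero]
      norm_num
      linarith
    | succ n =>
      obtain ⟨hx, hy⟩ := hessAux_vals P hP0 hP1 hP n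
      have h8 := hy 3
      norm_num at h8
      have h5 : P (2 * n + 5) = 2 * P (2 * n + 4) + P (2 * n + 3) := hP (2 * n + 3)
      have h6 : P (2 * (n + 1 + 2)) = 2 * P (2 * n + 5) + P (2 * n + 4) := hP (2 * n + 4)
      rw [hessAux_succ, hx, h8, h6, h5]
      ring
end

section
/- For every natural number n, the number of perfect matchings of the ladder graph pathGraph 2 □ pathGraph (n+1) (the 2 × (n+1) grid graph, i.e., the straight snake graph with n tiles) equals fib (n+2). -/
/-- The subsets of `{0, …, n-1}` without two consecutive elements. -/
def ladderSets (n : ℕ) : Finset (Finset ℕ) :=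
  (Finset.range n).powerset.filter (fun S => ∀ i ∈ S, i + 1 ∉ S)

theorem mem_ladderSets {n : ℕ} {S : Finset ℕ} :
    S ∈ ladderSets n ↔ (∀ i ∈ S, i < n) ∧ ∀ i ∈ S, i + 1 ∉ S := by
  simp [ladderSets, Finset.subset_iff]

theorem ladderSets_succ (n : ℕ) :
    ladderSets (n + 2) = ladderSets (n + 1) ∪ (ladderSets n).image (insert (n + 1)) := by
  ext S
  simp only [Finset.mem_union, Finset.mem_image, mem_ladderSets]
  constructor
  · rintro ⟨h1, h2⟩
    by_cases h : n + 1 ∈ S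
    · right
      refine ⟨S.erase (n + 1), ⟨?_, ?_⟩, Finset.insert_erase h⟩
      · intro i hi
        rw [Finset.mem_erase] at hi
        have := h1 i hi.2
        have h3 : i ≠ n := fun e => h2 i hi.2 (e ▸ h)
        omega
      · intro i hi hi'
        rw [Finset.mem_erase] at hi hi'
        exact h2 i hi.2 hi'.2
    · left
      refine ⟨fun i hi => ?_, h2⟩
      have := h1 i hi
      have : i ≠ n + 1 := fun e => h (e ▸ hi)
      omega
  · rintro (⟨h1, h2⟩ | ⟨T, ⟨h1, h2⟩, rfl⟩)
    · exact ⟨fun i hi => by have := h1 i hi; omega, h2⟩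
    · constructor
      · intro i hi
        rcases Finset.mem_insert.1 hi with h | h
        · omega
        · have := h1 i h; omega
      · intro i hi hi'
        rcases Finset.mem_insert.1 hi with h | h <;> rcases Finset.mem_insert.1 hi' with h' | h'
        · omega
        · have := h1 _ h'; omega
        · have := h1 _ h; omega
        · exact h2 i h h'

theorem card_ladderSets (n : ℕ) : (ladderSets n).card = Nat.fib (n + 2) := by
  induction n using Nat.twoStepInduction with
  | zero => decide
  | one => decide
  | more n ih1 ih2 =>
    rw [ladderSets_succ, Finset.card_union_of_disjoint, Finset.card_image_of_injOn, ih1, ih2,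
      Nat.fib_add_two (n := n + 2), add_comm]
    · intro S hS T hT h
      have hS' := (mem_ladderSets.1 hS).1
      have hT' := (mem_ladderSets.1 hT).1
      ext i
      have hi : i ∈ insert (n + 1) S ↔ i ∈ insert (n + 1) T := by
        have h : insert (n + 1) S = insert (n + 1) T := h
        rw [h]
      simp only [Finset.mem_insert] at hi
      constructor
      · intro h'
        have := hS' i h'
        rcases hi.1 (Or.inr h') with h | h
        · omega
        · exact h
      · intro h'
        have := hT' i h'
        rcases hi.2 (Or.inr h') with h | h
        · omega
        · exact h
    · rw [Finset.disjoint_left]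
      intro S hS hS'
      obtain ⟨T, -, rfl⟩ := Finset.mem_image.1 hS'
      have := (mem_ladderSets.1 hS).1 (n + 1) (Finset.mem_insert_self _ _)
      omega

/-- The adjacency relation of the matching attached to a set `S`. -/
def ladderRel (S : Finset ℕ) (r i s j : ℕ) : Prop :=
  (r ≠ s ∧ i = j ∧ i ∉ S ∧ ∀ k ∈ S, k + 1 ≠ i) ∨
    (r = s ∧ ((i + 1 = j ∧ i ∈ S) ∨ (j + 1 = i ∧ j ∈ S)))

theorem ladderRel_of_abstract (n : ℕ) (P : ℕ → ℕ → ℕ → ℕ → Prop) (S : Finset ℕ)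
    (hsymm : ∀ r i s j, P r i s j → P s j r i)
    (hbd : ∀ r i s j, P r i s j → r < 2 ∧ i < n + 1 ∧ s < 2 ∧ j < n + 1 ∧
      ((r ≠ s ∧ i = j) ∨ (r = s ∧ (i + 1 = j ∨ j + 1 = i))))
    (huniq : ∀ r i s j s' j', P r i s j → P r i s' j' → s = s' ∧ j = j')
    (hex : ∀ r i, r < 2 → i < n + 1 → ∃ s j, P r i s j)
    (hS : ∀ i, i ∈ S ↔ P 0 i 0 (i + 1)) (r i s j : ℕ)
    (hr : r < 2) (hi : i < n + 1) (hs : s < 2) (_hj : j < n + 1) :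
    P r i s j ↔ ladderRel S r i s j := by
  -- every vertex is matched right, left or across
  have hcase : ∀ r i, r < 2 → i < n + 1 →
      P r i r (i + 1) ∨ (∃ k, i = k + 1 ∧ P r k r i) ∨ P r i (1 - r) i := by
    intro r i hr hi
    obtain ⟨s, j, h⟩ := hex r i hr hi
    obtain ⟨-, -, hs, -, h'⟩ := hbd _ _ _ _ h
    rcases h' with ⟨h1, rfl⟩ | ⟨rfl, rfl | rfl⟩
    · right; right
      have : s = 1 - r := by omega
      exact this ▸ h
    · exact Or.inl h
    · exact Or.inr (Or.inl ⟨j, rfl, hsymm _ _ _ _ h⟩)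
  have hstep : ∀ i r, r < 2 → P r i r (i + 1) → P (1 - r) i (1 - r) (i + 1) := by
    intro i
    induction i with
    | zero =>
      intro r hr h
      rcases hcase (1 - r) 0 (by omega) (by omega) with h1 | ⟨k, hk, -⟩ | h1
      · exact h1
      · omega
      · have e : 1 - (1 - r) = r := by omega
        rw [e] at h1
        have := huniq _ _ _ _ _ _ h (hsymm _ _ _ _ h1)
        omega
    | succ i ih =>
      intro r hr h
      have hb := hbd _ _ _ _ h
      have e : 1 - (1 - r) = r := by omega
      rcases hcase (1 - r) (i + 1) (by omega) (by omega) with h1 | ⟨k, hk, h1⟩ | h1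
      · exact h1
      · obtain rfl : i = k := by omega
        have h2 := ih _ (by omega) h1
        rw [e] at h2
        have := huniq _ _ _ _ _ _ h (hsymm _ _ _ _ h2)
        omega
      · rw [e] at h1
        have := huniq _ _ _ _ _ _ h (hsymm _ _ _ _ h1)
        omega
  have hS' : ∀ r i, r < 2 → (i ∈ S ↔ P r i r (i + 1)) := by
    intro r i hr
    rw [hS]
    obtain rfl | rfl : r = 0 ∨ r = 1 := by omega
    · rfl
    · exact ⟨hstep i 0 (by omega), hstep i 1 (by omega)⟩
  unfold ladderRel
  constructor
  · intro h
    rcases (hbd _ _ _ _ h).2.2.2.2 with ⟨h1, rfl⟩ | ⟨rfl, rfl | rfl⟩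
    · refine Or.inl ⟨h1, rfl, fun hm => ?_, ?_⟩
      · have := huniq _ _ _ _ _ _ h ((hS' r i hr).1 hm)
        omega
      · rintro k hk rfl
        have := huniq _ _ _ _ _ _ h (hsymm _ _ _ _ ((hS' r k hr).1 hk))
        omega
    · exact Or.inr ⟨rfl, Or.inl ⟨rfl, (hS' r i hr).2 h⟩⟩
    · exact Or.inr ⟨rfl, Or.inr ⟨rfl, (hS' r j hr).2 (hsymm _ _ _ _ h)⟩⟩
  · rintro (⟨h1, rfl, h2, h3⟩ | ⟨rfl, ⟨rfl, h⟩ | ⟨rfl, h⟩⟩)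
    · rcases hcase r i hr hi with h | ⟨k, hk, h⟩ | h
      · exact absurd ((hS' r i hr).2 h) h2
      · subst hk
        exact absurd rfl (h3 k ((hS' r k hr).2 h))
      · have : s = 1 - r := by omega
        exact this ▸ h
    · exact (hS' r i hr).1 h
    · exact hsymm _ _ _ _ ((hS' r j hr).1 h)

/-- The ladder graph. -/
abbrev ladderG (n : ℕ) := (SimpleGraph.pathGraph 2).boxProd (SimpleGraph.pathGraph (n + 1))

theorem ladderG_adj {n : ℕ} (x y : Fin 2 × Fin (n + 1)) : (ladderG n).Adj x y ↔
    ((x.1.1 ≠ y.1.1 ∧ x.2.1 = y.2.1) ∨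
      (x.1.1 = y.1.1 ∧ (x.2.1 + 1 = y.2.1 ∨ y.2.1 + 1 = x.2.1))) := by
  rw [SimpleGraph.boxProd_adj, SimpleGraph.pathGraph_adj, SimpleGraph.pathGraph_adj,
    Fin.ext_iff, Fin.ext_iff]
  have := x.1.2
  have := y.1.2
  omega

/-- The subgraph attached to a set. -/
def ladderSub (n : ℕ) (S : Finset ℕ) : (ladderG n).Subgraph where
  verts := Set.univ
  Adj x y := ladderRel S x.1 x.2 y.1 y.2
  adj_sub := by
    intro x y h
    rw [ladderG_adj]
    unfold ladderRel at h
    tauto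
  edge_vert := by intros; trivial
  symm := by
    constructor
    intro x y h
    unfold ladderRel at *
    rcases h with ⟨h1, h2, h3⟩ | ⟨h1, h2⟩
    · exact Or.inl ⟨h1.symm, h2.symm, h2 ▸ h3⟩
    · exact Or.inr ⟨h1.symm, h2.symm⟩

theorem ladderSub_perfect (n : ℕ) (S : Finset ℕ) (hS : S ∈ ladderSets n) :
    (ladderSub n S).IsPerfectMatching := by
  rw [mem_ladderSets] at hS
  obtain ⟨h1, h2⟩ := hS
  rw [SimpleGraph.Subgraph.isPerfectMatching_iff]
  rintro ⟨⟨r, hr⟩, ⟨i, hi⟩⟩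
  have key : ∀ s j (hs : s < 2) (hj : j < n + 1), ladderRel S r i s j →
      (∀ s' j', s' < 2 → ladderRel S r i s' j' → s' = s ∧ j' = j) →
      ∃! w, (ladderSub n S).Adj (⟨r, hr⟩, ⟨i, hi⟩) w := by
    intro s j hs hj h hu
    refine ⟨(⟨s, hs⟩, ⟨j, hj⟩), h, ?_⟩
    rintro ⟨⟨s', hs'⟩, ⟨j', hj'⟩⟩ h'
    obtain ⟨rfl, rfl⟩ := hu s' j' hs' h'
    rfl
  by_cases hm : i ∈ S
  · refine key r (i + 1) hr (by have := h1 i hm; omega) (Or.inr ⟨rfl, Or.inl ⟨rfl, hm⟩⟩) ?_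
    rintro s' j' hs' (⟨-, -, h, -⟩ | ⟨rfl, ⟨rfl, h⟩ | ⟨rfl, h⟩⟩)
    · exact absurd hm h
    · exact ⟨rfl, rfl⟩
    · exact absurd hm (h2 _ h)
  · by_cases hk : ∃ k ∈ S, k + 1 = i
    · obtain ⟨k, hk, rfl⟩ := hk
      refine key r k hr (by omega) (Or.inr ⟨rfl, Or.inr ⟨rfl, hk⟩⟩) ?_
      rintro s' j' hs' (⟨-, -, -, h⟩ | ⟨rfl, ⟨rfl, h⟩ | ⟨h', h⟩⟩)
      · exact absurd rfl (h k hk)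
      · exact absurd h hm
      · exact ⟨rfl, by omega⟩
    · push Not at hk
      refine key (1 - r) i (by omega) hi (Or.inl ⟨by omega, rfl, hm, hk⟩) ?_
      rintro s' j' hs' (⟨h, h', -, -⟩ | ⟨rfl, ⟨rfl, h⟩ | ⟨h', h⟩⟩)
      · omega
      · exact absurd h hm
      · exact absurd h' (hk _ h)

/-- The relation on natural numbers attached to a subgraph. -/
def ladderP {n : ℕ} (M : (ladderG n).Subgraph) (r i s j : ℕ) : Prop :=
  ∃ (hr : r < 2) (hi : i < n + 1) (hs : s < 2) (hj : j < n + 1),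
    M.Adj (⟨r, hr⟩, ⟨i, hi⟩) (⟨s, hs⟩, ⟨j, hj⟩)

theorem exists_ladderSet {n : ℕ} (M : (ladderG n).Subgraph) (hM : M.IsPerfectMatching) :
    ∃ S ∈ ladderSets n, ladderSub n S = M := by
  classical
  rw [SimpleGraph.Subgraph.isPerfectMatching_iff] at hM
  have hbd : ∀ r i s j, ladderP M r i s j → r < 2 ∧ i < n + 1 ∧ s < 2 ∧ j < n + 1 ∧
      ((r ≠ s ∧ i = j) ∨ (r = s ∧ (i + 1 = j ∨ j + 1 = i))) := by
    rintro r i s j ⟨hr, hi, hs, hj, h⟩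
    exact ⟨hr, hi, hs, hj, (ladderG_adj _ _).1 h.adj_sub⟩
  have hsymm : ∀ r i s j, ladderP M r i s j → ladderP M s j r i := by
    rintro r i s j ⟨hr, hi, hs, hj, h⟩
    exact ⟨hs, hj, hr, hi, h.symm⟩
  have huniq : ∀ r i s j s' j', ladderP M r i s j → ladderP M r i s' j' → s = s' ∧ j = j' := by
    rintro r i s j s' j' ⟨hr, hi, hs, hj, h⟩ ⟨_, _, hs', hj', h'⟩
    have := (hM _).unique h h'
    simpa using this
  have hex : ∀ r i, r < 2 → i < n + 1 → ∃ s j, ladderP M r i s j := by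
    intro r i hr hi
    obtain ⟨w, hw, -⟩ := hM (⟨r, hr⟩, ⟨i, hi⟩)
    exact ⟨w.1, w.2, hr, hi, w.1.2, w.2.2, hw⟩
  let S := (Finset.range n).filter (fun i => ladderP M 0 i 0 (i + 1))
  have hS : ∀ i, i ∈ S ↔ ladderP M 0 i 0 (i + 1) := by
    intro i
    simp only [S, Finset.mem_filter, Finset.mem_range, and_iff_right_iff_imp]
    intro h
    have := hbd _ _ _ _ h
    omega
  refine ⟨S, mem_ladderSets.2 ⟨fun i hi => ?_, fun i hi hi' => ?_⟩, ?_⟩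
  · have := hbd _ _ _ _ ((hS i).1 hi)
    omega
  · have := huniq _ _ _ _ _ _ (hsymm _ _ _ _ ((hS i).1 hi)) ((hS _).1 hi')
    omega
  · ext x y
    · simp only [ladderSub, Set.mem_univ, true_iff]
      obtain ⟨w, hw, -⟩ := hM x
      exact hw.fst_mem
    · have := ladderRel_of_abstract n (ladderP M) S hsymm hbd huniq hex hS
        x.1 x.2 y.1 y.2 x.1.2 x.2.2 y.1.2 y.2.2
      change ladderRel S x.1 x.2 y.1 y.2 ↔ _
      rw [← this]
      exact ⟨fun ⟨_, _, _, _, h⟩ => h, fun h => ⟨_, _, _, _, h⟩⟩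

theorem ladderSub_injOn {n : ℕ} {S T : Finset ℕ} (hS : S ∈ ladderSets n) (hT : T ∈ ladderSets n)
    (h : ladderSub n S = ladderSub n T) : S = T := by
  have key : ∀ U : Finset ℕ, ∀ i (hi : i < n), i ∈ U ↔ (ladderSub n U).Adj
      (0, ⟨i, by omega⟩) (0, ⟨i + 1, by omega⟩) := by
    intro U i hi
    simp [ladderSub, ladderRel]
    omega
  ext i
  constructor
  · intro hi
    have hn := (mem_ladderSets.1 hS).1 i hi
    rwa [key _ i hn, ← h, ← key _ i hn]
  · intro hi
    have hn := (mem_ladderSets.1 hT).1 i hi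
    rwa [key _ i hn, h, ← key _ i hn]

/-- For every natural number `n`, the number of perfect matchings of the ladder graph
`pathGraph 2 □ pathGraph (n+1)` (the `2 × (n+1)` grid graph, i.e. the straight snake
graph with `n` tiles) equals `fib (n+2)`. -/
theorem card_perfectMatchings_ladder (n : ℕ) :
    Nat.card {M : ((SimpleGraph.pathGraph 2).boxProd
        (SimpleGraph.pathGraph (n + 1))).Subgraph // M.IsPerfectMatching}
      = Nat.fib (n + 2) := by
  rw [← card_ladderSets, ← Nat.card_eq_finsetCard]
  symm
  refine Nat.card_eq_of_bijective
    (fun S : ladderSets n => ⟨ladderSub n S.1, ladderSub_perfect n S.1 S.2⟩) ⟨?_, ?_⟩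
  · rintro ⟨S, hS⟩ ⟨T, hT⟩ h
    exact Subtype.ext (ladderSub_injOn hS hT (congrArg Subtype.val h))
  · rintro ⟨M, hM⟩
    obtain ⟨S, hS, h⟩ := exists_ladderSet M hM
    exact ⟨⟨S, hS⟩, Subtype.ext h⟩
end
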